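/- Assume (ρ,∼) is strongly commutative, (F,∼) is a potential causality graph, λ satisfies condition (A), and (λ,μ,θ) satisfy the cluster-expansion condition. Fix a flaw f ∈ F and an integer s ≥ 1, and let X be a valid set of walks such that every τ ∈ X contains a chain of length s ending with f. Then ∑_{τ∈X} p(τ) ≤ γ^init · μ_f · θ^s. Consequently, if X is a valid set of walks each containing a chain of length s, then ∑_{τ∈X} p(τ) ≤ γ^init · (∑_{f∈F} μ_f) · θ^s. -/

import Mathlib

open scoped Classical

noncomputable section

namespace LLLFormal

/-- A walk: an initial state together with a list of (flaw, next-state) steps. -/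
structure Walk (Ω F : Type*) where
  start : Ω
  steps : List (F × Ω)

variable {Ω F : Type*}

/-- Validity of a list of steps from a given state, w.r.t. a step relation. -/
def ValidFrom (step : F → Ω → Ω → Prop) : Ω → List (F × Ω) → Prop
  | _, [] => True
  | σ, (f, σ') :: rest => step f σ σ' ∧ ValidFrom step σ' rest

/-- The state reached after performing the steps `l` starting from `σ`. -/
def endOf (σ : Ω) (l : List (F × Ω)) : Ω := (l.map Prod.snd).getLastD σ

/-- `τ` is a (valid) walk w.r.t. the step relation `step`. -/
def Walk.Valid (step : F → Ω → Ω → Prop) (τ : Walk Ω F) : Prop := ValidFrom step τ.start τ.steps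

/-- The flaw word of a walk. -/
def Walk.word (τ : Walk Ω F) : List F := τ.steps.map Prod.fst

/-- The final state of a walk. -/
def Walk.final (τ : Walk Ω F) : Ω := endOf τ.start τ.steps

/-- The length of a walk. -/
def Walk.len (τ : Walk Ω F) : ℕ := τ.steps.length

/-- Product of the transition probabilities along a list of steps. -/
def prodRho (ρ : F → Ω → Ω → ℝ) : Ω → List (F × Ω) → ℝ
  | _, [] => 1
  | σ, (f, σ') :: rest => ρ f σ σ' * prodRho ρ σ' rest

/-- The weight `p(τ)` of a walk. -/
def Walk.wt (ωinit : Ω → ℝ) (ρ : F → Ω → Ω → ℝ) (τ : Walk Ω F) : ℝ :=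
  ωinit τ.start * prodRho ρ τ.start τ.steps

/-- `λ_W = ∏_i λ_{w_i}`. -/
def wordWt (lam : F → ℝ) (W : List F) : ℝ := (W.map lam).prod

/-- The data of the objects, flaws, actions and resampling oracles:
`mem f σ` means `σ ∈ f`; `Act f σ` is the action set `A(f,σ)`;
`ρ f σ σ'` is the probability `ρ(σ'|f,σ)`, whose support is exactly `A(f,σ)`. -/
structure Setup (Ω F : Type*) [Fintype Ω] where
  mem : F → Ω → Prop
  flaw_nonempty : ∀ f, ∃ σ, mem f σ
  Act : F → Ω → Set Ω
  act_nonempty : ∀ f σ, mem f σ → (Act f σ).Nonempty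
  ρ : F → Ω → Ω → ℝ
  ρ_nonneg : ∀ f σ σ', 0 ≤ ρ f σ σ'
  ρ_support : ∀ f σ, mem f σ → ∀ σ', (0 < ρ f σ σ' ↔ σ' ∈ Act f σ)
  ρ_total : ∀ f σ, mem f σ → ∑ σ' : Ω, ρ f σ σ' = 1

variable [Fintype Ω]

/-- A valid step `σ →^f σ'`. -/
def Setup.step (S : Setup Ω F) (f : F) (σ σ' : Ω) : Prop := S.mem f σ ∧ σ' ∈ S.Act f σ

/-- A probability distribution on `Ω`. -/
def IsProb (ω : Ω → ℝ) : Prop := (∀ σ, 0 ≤ ω σ) ∧ ∑ σ : Ω, ω σ = 1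

/-- A probability distribution on `Ω` with full support. -/
def IsPosProb (ω : Ω → ℝ) : Prop := (∀ σ, 0 < ω σ) ∧ ∑ σ : Ω, ω σ = 1

/-- `γ^init = max_{σ∈Ω} ωinit σ / ω σ`. -/
def gammaInit [Nonempty Ω] (ωinit ω : Ω → ℝ) : ℝ :=
  Finset.univ.sup' Finset.univ_nonempty fun σ => ωinit σ / ω σ

/-- Condition (A): `λ_f ≥ ∑_{σ ∈ f : σ' ∈ A(f,σ)} ρ(σ'|f,σ) ω(σ)/ω(σ')`. -/
def CondA (S : Setup Ω F) (ω : Ω → ℝ) (lam : F → ℝ) : Prop :=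
  ∀ (f : F) (σ' : Ω),
    lam f ≥ ∑ σ : Ω, if S.mem f σ ∧ σ' ∈ S.Act f σ then S.ρ f σ σ' * ω σ / ω σ' else 0

/-- `(F, ∼)` is a potential causality graph:
for every valid step `σ →^f σ'`, `F_{σ'} ⊆ (F_σ − {f}) ∪ Γ(f)`. -/
def Causality (S : Setup Ω F) (sim : F → F → Prop) : Prop :=
  ∀ f σ σ', S.step f σ σ' → ∀ g, S.mem g σ' → (S.mem g σ ∧ g ≠ f) ∨ sim f g

/-- A finite set of flaws is independent. -/
def IndepF (sim : F → F → Prop) (I : Finset F) : Prop :=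
  ∀ f ∈ I, ∀ g ∈ I, f ≠ g → ¬ sim f g

/-- `B` is a partition of the word `W` into consecutive nonempty blocks of distinct,
pairwise non-neighbouring flaws, with each block contained in `Γ⁺` of the previous one. -/
def StablePartition (sim : F → F → Prop) (B : List (List F)) (W : List F) : Prop :=
  W = B.flatten ∧
  (∀ b ∈ B, b ≠ [] ∧ b.Nodup ∧ b.Pairwise fun f g => ¬ sim f g) ∧
  B.Chain' fun b₁ b₂ => ∀ g ∈ b₂, ∃ f ∈ b₁, f = g ∨ sim f g

/-- A stable word. -/
def StableWord (sim : F → F → Prop) (W : List F) : Prop := ∃ B, StablePartition sim B W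

/-- A stable partition whose blocks are listed in strictly increasing order. -/
def PiStablePartition [LinearOrder F] (sim : F → F → Prop) (B : List (List F))
    (W : List F) : Prop :=
  StablePartition sim B W ∧ ∀ b ∈ B, b.Chain' (· < ·)

/-- A π-stable word. -/
def PiStableWord [LinearOrder F] (sim : F → F → Prop) (W : List F) : Prop :=
  ∃ B, PiStablePartition sim B W

/-- A deterministic strategy: it assigns to every walk whose final state is flawed
a flaw present in the final state. -/
def IsStrategy (S : Setup Ω F) (Λ : Walk Ω F → F) : Prop :=
  ∀ τ : Walk Ω F, Walk.Valid S.step τ → (∃ f, S.mem f (Walk.final τ)) →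
    S.mem (Λ τ) (Walk.final τ)

/-- A walk follows the strategy `Λ`. -/
def Follows (Λ : Walk Ω F → F) (τ : Walk Ω F) : Prop :=
  ∀ (i : ℕ) (h : i < τ.steps.length),
    (τ.steps.get ⟨i, h⟩).1 = Λ ⟨τ.start, τ.steps.take i⟩

/-- The set `Bad(t)` of bad `t`-trajectories. -/
def Bad (S : Setup Ω F) (Λ : Walk Ω F → F) (ωinit : Ω → ℝ) (t : ℕ) : Set (Walk Ω F) :=
  {τ | Walk.Valid S.step τ ∧ Walk.len τ = t ∧ Follows Λ τ ∧ 0 < ωinit τ.start}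

/-- The cluster-expansion condition:
`(λ_f/μ_f) ∑_{S ∈ Ind(Γ(f))} μ(S) ≤ θ` for every flaw `f`. -/
def ClusterCond [Fintype F] (sim : F → F → Prop) (lam μ : F → ℝ) (θ : ℝ) : Prop :=
  ∀ f : F,
    lam f / μ f *
      ∑ I ∈ Finset.univ.filter (fun I : Finset F => (∀ g ∈ I, sim f g) ∧ IndepF sim I),
        ∏ g ∈ I, μ g ≤ θ

/-- `τ` is a prefix of `τ'`. -/
def Walk.IsPrefix (τ τ' : Walk Ω F) : Prop := τ.start = τ'.start ∧ τ.steps <+: τ'.steps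

/-- A valid set of walks: all walks follow one common deterministic strategy,
and no walk is a proper prefix of another one. -/
def ValidSet (S : Setup Ω F) (X : Set (Walk Ω F)) : Prop :=
  (∀ τ ∈ X, Walk.Valid S.step τ) ∧
  (∃ Λ : Walk Ω F → F, IsStrategy S Λ ∧ ∀ τ ∈ X, Follows Λ τ) ∧
  ∀ τ ∈ X, ∀ τ' ∈ X, Walk.IsPrefix τ τ' → τ = τ'

/-- Atomicity of the resampling oracles. -/
def Atomic (S : Setup Ω F) : Prop :=
  ∀ f σ' σ₁ σ₂, S.step f σ₁ σ' → S.step f σ₂ σ' → σ₁ = σ₂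

/-- The map `swap` sends every swappable pair of steps to a valid pair of steps. -/
def SwapValid (S : Setup Ω F) (sim : F → F → Prop) (swap : Ω → F → Ω → F → Ω → Ω) : Prop :=
  ∀ σ₁ f σ₂ g σ₃, S.step f σ₁ σ₂ → S.step g σ₂ σ₃ → ¬ sim f g →
    S.step g σ₁ (swap σ₁ f σ₂ g σ₃) ∧ S.step f (swap σ₁ f σ₂ g σ₃) σ₃

/-- The map `swap` is injective (as a map of two-step walks). -/
def SwapInj (S : Setup Ω F) (sim : F → F → Prop) (swap : Ω → F → Ω → F → Ω → Ω) : Prop :=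
  ∀ σ₁ f σ₂ τ₂ g σ₃, S.step f σ₁ σ₂ → S.step g σ₂ σ₃ → S.step f σ₁ τ₂ → S.step g τ₂ σ₃ →
    ¬ sim f g → swap σ₁ f σ₂ g σ₃ = swap σ₁ f τ₂ g σ₃ → σ₂ = τ₂

/-- The map `swap` preserves the product of the two transition probabilities. -/
def SwapProb (S : Setup Ω F) (sim : F → F → Prop) (swap : Ω → F → Ω → F → Ω → Ω) : Prop :=
  ∀ σ₁ f σ₂ g σ₃, S.step f σ₁ σ₂ → S.step g σ₂ σ₃ → ¬ sim f g →
    S.ρ f σ₁ σ₂ * S.ρ g σ₂ σ₃ =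
      S.ρ g σ₁ (swap σ₁ f σ₂ g σ₃) * S.ρ f (swap σ₁ f σ₂ g σ₃) σ₃

/-- `(ρ, ∼)` is weakly commutative. -/
def WeakComm (S : Setup Ω F) (sim : F → F → Prop) : Prop :=
  ∃ swap, SwapValid S sim swap ∧ SwapInj S sim swap

/-- `(ρ, ∼)` is strongly commutative. -/
def StrongComm (S : Setup Ω F) (sim : F → F → Prop) : Prop :=
  ∃ swap, SwapValid S sim swap ∧ SwapInj S sim swap ∧ SwapProb S sim swap

/-- One valid swap transforming the walk `τ` into the walk `τ'`. -/
def SwapStep (S : Setup Ω F) (sim : F → F → Prop) (swap : Ω → F → Ω → F → Ω → Ω)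
    (τ τ' : Walk Ω F) : Prop :=
  ∃ (A B : List (F × Ω)) (f g : F) (σ₂ σ₃ : Ω),
    f ≠ g ∧ ¬ sim f g ∧
    S.step f (endOf τ.start A) σ₂ ∧ S.step g σ₂ σ₃ ∧
    τ.steps = A ++ (f, σ₂) :: (g, σ₃) :: B ∧
    τ' = ⟨τ.start, A ++ (g, swap (endOf τ.start A) f σ₂ g σ₃) :: (f, σ₃) :: B⟩

/-- `U` is a chain of the walk `τ`. -/
def IsChainOf (sim : F → F → Prop) (U : List F) (τ : Walk Ω F) : Prop :=
  U.Sublist (Walk.word τ) ∧ U.Chain' fun a b => a = b ∨ sim a b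

/-- The longest prefix of `W` ending with `f` (empty if `f` does not occur in `W`). -/
def prefEnd (f : F) (W : List F) : List F :=
  (W.reverse.dropWhile fun x => decide (x ≠ f)).reverse

/-- `W^f_τ` for `f ∈ F ∪ {∅}`. -/
def prefOpt (fo : Option F) (W : List F) : List F :=
  match fo with
  | none => W
  | some f => prefEnd f W

/-- `g ∈ Γ⁺(I)` for a list `I` of flaws. -/
def GammaPlusL (sim : F → F → Prop) (I : List F) (g : F) : Prop := ∃ f ∈ I, f = g ∨ sim f g

/-- The steps of one round, starting at state `σ` with already-addressed flaws `I`: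
each addressed flaw `f` satisfies `f ∈ F_σ − Γ⁺(I)` and the step is valid. -/
def RoundFrom (S : Setup Ω F) (sim : F → F → Prop) : Ω → List F → List (F × Ω) → Prop
  | _, _, [] => True
  | σ, I, (f, σ') :: rest =>
      S.mem f σ ∧ ¬ GammaPlusL sim I f ∧ σ' ∈ S.Act f σ ∧
      RoundFrom S sim σ' (I ++ [f]) rest

/-- Like `RoundFrom`, but the addressed flaw is moreover the `≼`-least of `F_σ − Γ⁺(I)`. -/
def RoundFromPi [LinearOrder F] (S : Setup Ω F) (sim : F → F → Prop) :
    Ω → List F → List (F × Ω) → Prop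
  | _, _, [] => True
  | σ, I, (f, σ') :: rest =>
      S.mem f σ ∧ ¬ GammaPlusL sim I f ∧
      (∀ g, S.mem g σ → ¬ GammaPlusL sim I g → f ≤ g) ∧
      σ' ∈ S.Act f σ ∧ RoundFromPi S sim σ' (I ++ [f]) rest

/-- A walk grouped into rounds: each round is valid, and at the final state of every
round except possibly the last one, `F_σ − Γ⁺(I_r) = ∅`. -/
def RoundsFrom (S : Setup Ω F) (sim : F → F → Prop) : Ω → List (List (F × Ω)) → Prop
  | _, [] => True
  | σ, b :: rest =>
      RoundFrom S sim σ [] b ∧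
      (rest = [] ∨
        ((∀ g, S.mem g (endOf σ b) → GammaPlusL sim (b.map Prod.fst) g) ∧
          RoundsFrom S sim (endOf σ b) rest))

/-- Like `RoundsFrom`, with the `≼`-least flaw selection rule. -/
def RoundsFromPi [LinearOrder F] (S : Setup Ω F) (sim : F → F → Prop) :
    Ω → List (List (F × Ω)) → Prop
  | _, [] => True
  | σ, b :: rest =>
      RoundFromPi S sim σ [] b ∧
      (rest = [] ∨
        ((∀ g, S.mem g (endOf σ b) → GammaPlusL sim (b.map Prod.fst) g) ∧
          RoundsFromPi S sim (endOf σ b) rest))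

/-- The family `Ind^init = ∪_{σ : ωinit σ > 0} Ind(F_σ)`. -/
def indInitSets [Fintype F] (S : Setup Ω F) (sim : F → F → Prop) (ωinit : Ω → ℝ) :
    Finset (Finset F) :=
  Finset.univ.filter fun R => IndepF sim R ∧ ∃ σ, 0 < ωinit σ ∧ ∀ f ∈ R, S.mem f σ

/-- `λ_φ` for a sequence of sets of flaws. -/
def seqWt (lam : F → ℝ) (φ : List (Finset F)) : ℝ := (φ.map fun I => ∏ f ∈ I, lam f).prod

/-- `|φ| = ∑_r |I_r|`. -/
def seqSize (φ : List (Finset F)) : ℕ := (φ.map Finset.card).sum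

/-- A strongly stable sequence. -/
def StronglyStableSeq (sim : F → F → Prop) (φ : List (Finset F)) : Prop :=
  φ ≠ [] ∧ (∀ I ∈ φ, IndepF sim I) ∧
  φ.Chain' (fun I J => ∀ g ∈ J, ∃ f ∈ I, sim f g) ∧
  ∀ I ∈ φ.tail, I ≠ ∅

/-- Membership in `Stab(R,S,t,ℓ)`. -/
def StabRSTL (sim : F → F → Prop) (R S : Finset F) (t ℓ : ℕ) (φ : List (Finset F)) : Prop :=
  φ.head? = some R ∧ φ.length ≤ ℓ ∧ t ≤ seqSize φ ∧
  ((φ.length = 1 ∧ S = ∅) ∨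
    (2 ≤ φ.length ∧ S = φ.tail.headI.filter (fun g => ¬ ∃ f ∈ R, sim f g) ∧
      StronglyStableSeq sim φ.tail))

/-- One valid swap on words. -/
def WordSwap (sim : F → F → Prop) (W W' : List F) : Prop :=
  ∃ (A B : List F) (f g : F), f ≠ g ∧ ¬ sim f g ∧ W = A ++ f :: g :: B ∧ W' = A ++ g :: f :: B

end LLLFormal

namespace LLLFormal

section Levels

variable {F : Type*}

/-- Some level of `L` contains `g` or a neighbour of `g`. -/
def Touches (sim : F → F → Prop) (g : F) (L : List (Finset F)) : Prop :=
  ∃ I ∈ L, ∃ h ∈ I, g = h ∨ sim h g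

/-- Add `g` to the first level. -/
def addHead (g : F) : List (Finset F) → List (Finset F)
  | [] => [{g}]
  | J :: R => insert g J :: R

/-- Add `g` just after the last level that it touches, if there is one. -/
def insertLevel (sim : F → F → Prop) (g : F) : List (Finset F) → List (Finset F)
  | [] => []
  | I :: R =>
      if Touches sim g R then I :: insertLevel sim g R
      else if Touches sim g [I] then I :: addHead g R
      else I :: R

/-- Remove `g` from the first level. -/
def eraseHead (g : F) : List (Finset F) → List (Finset F)
  | [] => []
  | I :: R => if I.erase g = ∅ then R else I.erase g :: R

/-- Remove `g` from the last level that it touches. -/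
def deleteLevel (sim : F → F → Prop) (g : F) : List (Finset F) → List (Finset F)
  | [] => []
  | I :: R => if Touches sim g R then I :: deleteLevel sim g R else eraseHead g (I :: R)

/-- Effect on the level decomposition of a word of prepending the letter `g`. -/
def prependLevel (sim : F → F → Prop) (f g : F) (L : List (Finset F)) : List (Finset F) :=
  if L = [] then (if g = f then [{f}] else []) else insertLevel sim g L

/-- Left inverse of `prependLevel`. -/
def unprependLevel (sim : F → F → Prop) (g : F) (L : List (Finset F)) : List (Finset F) :=
  if Touches sim g L then deleteLevel sim g L else L

/-- The letters of a word that are forced to precede its last `f`, arranged according to the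
length of the longest chain leading to that `f`; the first level is `{f}`. -/
def levels (sim : F → F → Prop) (f : F) : List F → List (Finset F)
  | [] => []
  | g :: w => prependLevel sim f g (levels sim f w)

/-- All levels are nonempty and independent. -/
def ProperLevels (sim : F → F → Prop) (L : List (Finset F)) : Prop :=
  ∀ I ∈ L, I.Nonempty ∧ IndepF sim I

/-- `L` is proper and each flaw has a neighbour in the preceding level. -/
def StableLevels (sim : F → F → Prop) : List (Finset F) → Prop
  | [] => True
  | I :: R => I.Nonempty ∧ IndepF sim I ∧ (∀ g ∈ R.headD ∅, ∃ h ∈ I, sim h g) ∧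
      StableLevels sim R

/-- `g` occurs in a level of `L` and touches no later level. -/
def Exposed (sim : F → F → Prop) (g : F) : List (Finset F) → Prop
  | [] => False
  | I :: R => Exposed sim g R ∨ (g ∈ I ∧ ¬ Touches sim g R)

/-- A word in which the last levels come first. -/
def levelWord : List (Finset F) → List F
  | [] => []
  | I :: R => levelWord R ++ I.toList

variable {sim : F → F → Prop}

lemma not_touches_nil (g : F) : ¬ Touches sim g [] := by simp [Touches]

lemma touches_cons {g : F} {I : Finset F} {R : List (Finset F)} :
    Touches sim g (I :: R) ↔ Touches sim g [I] ∨ Touches sim g R := by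
  simp [Touches]

lemma touches_singleton {g : F} {I : Finset F} :
    Touches sim g [I] ↔ ∃ h ∈ I, g = h ∨ sim h g := by
  simp [Touches]

lemma touches_singleton_of_mem {g : F} {I : Finset F} (h : g ∈ I) : Touches sim g [I] :=
  touches_singleton.2 ⟨g, h, Or.inl rfl⟩

lemma touches_addHead_self (g : F) (L : List (Finset F)) : Touches sim g (addHead g L) := by
  cases L with
  | nil => exact touches_singleton_of_mem (by simp)
  | cons I R => exact touches_cons.2 (Or.inl (touches_singleton_of_mem (by simp)))

lemma insertLevel_of_not_touches {g : F} {L : List (Finset F)} (h : ¬ Touches sim g L) :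
    insertLevel sim g L = L := by
  cases L with
  | nil => rfl
  | cons I R =>
    rw [touches_cons, not_or] at h
    simp [insertLevel, h.1, h.2]

lemma touches_insertLevel_self {g : F} {L : List (Finset F)} :
    Touches sim g (insertLevel sim g L) ↔ Touches sim g L := by
  induction L with
  | nil => rfl
  | cons I R ih =>
    unfold insertLevel
    split_ifs with h1 h2
    · rw [touches_cons, touches_cons (R := R), ih]
    · rw [touches_cons, touches_cons (R := R)]
      simp [touches_addHead_self, h2]
    · rfl

lemma eraseHead_addHead {g : F} {L : List (Finset F)} (hL : ProperLevels sim L)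
    (hg : ¬ Touches sim g L) : eraseHead g (addHead g L) = L := by
  cases L with
  | nil => simp [addHead, eraseHead]
  | cons J R =>
    have hgJ : g ∉ J := fun h => hg (touches_cons.2 (Or.inl (touches_singleton_of_mem h)))
    have hJ : J ≠ ∅ := (hL J (by simp)).1.ne_empty
    simp [addHead, eraseHead, Finset.erase_insert hgJ, hJ]

lemma deleteLevel_addHead {g : F} {L : List (Finset F)} (hL : ProperLevels sim L)
    (hg : ¬ Touches sim g L) : deleteLevel sim g (addHead g L) = L := by
  have h := eraseHead_addHead hL hg
  cases L with
  | nil => simpa [addHead, deleteLevel, not_touches_nil] using h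
  | cons J R =>
    rw [touches_cons, not_or] at hg
    simpa [addHead, deleteLevel, hg.2] using h

lemma deleteLevel_insertLevel {g : F} {L : List (Finset F)} (hL : ProperLevels sim L)
    (hg : Touches sim g L) : deleteLevel sim g (insertLevel sim g L) = L := by
  induction L with
  | nil => exact absurd hg (not_touches_nil g)
  | cons I R ih =>
    have hR : ProperLevels sim R := fun J hJ => hL J (by simp [hJ])
    unfold insertLevel
    split_ifs with h1 h2
    · rw [deleteLevel, if_pos (touches_insertLevel_self.2 h1), ih hR h1]
    · rw [deleteLevel, if_pos (touches_addHead_self g R), deleteLevel_addHead hR h1]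
    · exact absurd (touches_cons.1 hg) (by tauto)

lemma prependLevel_eq_of_not_touches {f g : F} {L : List (Finset F)}
    (hg : ¬ Touches sim g (prependLevel sim f g L)) : prependLevel sim f g L = L := by
  unfold prependLevel at hg ⊢
  split_ifs at hg ⊢ with h1 h2
  · exact absurd (touches_singleton_of_mem (by simp [h2])) hg
  · exact h1.symm
  · rw [touches_insertLevel_self] at hg
    exact insertLevel_of_not_touches hg

lemma unprependLevel_prependLevel (f g : F) {L : List (Finset F)} (hL : ProperLevels sim L) :
    unprependLevel sim g (prependLevel sim f g L) = L := by
  by_cases hg : Touches sim g (prependLevel sim f g L)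
  · rw [unprependLevel, if_pos hg]
    unfold prependLevel at hg ⊢
    split_ifs at hg ⊢ with h1 h2
    · subst h1 h2
      exact deleteLevel_addHead hL (not_touches_nil g)
    · exact absurd hg (not_touches_nil g)
    · exact deleteLevel_insertLevel hL (touches_insertLevel_self.1 hg)
  · rw [unprependLevel, if_neg hg, prependLevel_eq_of_not_touches hg]

lemma indepF_insert (hsym : Symmetric sim) {g : F} {I : Finset F} (hI : IndepF sim I)
    (hg : ¬ Touches sim g [I]) : IndepF sim (insert g I) := by
  simp only [touches_singleton, not_exists, not_and, not_or] at hg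
  intro a ha b hb hab
  rw [Finset.mem_insert] at ha hb
  rcases ha with rfl | ha <;> rcases hb with rfl | hb
  · exact absurd rfl hab
  · exact fun h => (hg b hb).2 (hsym h)
  · exact (hg a ha).2
  · exact hI a ha b hb hab

lemma properLevels_cons {I : Finset F} {R : List (Finset F)} :
    ProperLevels sim (I :: R) ↔ (I.Nonempty ∧ IndepF sim I) ∧ ProperLevels sim R := by
  simp [ProperLevels]

lemma properLevels_singleton (f : F) : ProperLevels sim [{f}] := by
  intro I hI
  rw [List.mem_singleton] at hI
  subst hI
  refine ⟨by simp, fun a ha b hb hab => ?_⟩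
  rw [Finset.mem_singleton] at ha hb
  exact absurd (ha.trans hb.symm) hab

lemma properLevels_addHead (hsym : Symmetric sim) {g : F} {L : List (Finset F)}
    (hL : ProperLevels sim L) (hg : ¬ Touches sim g L) : ProperLevels sim (addHead g L) := by
  cases L with
  | nil => exact properLevels_singleton g
  | cons J R =>
    rw [properLevels_cons] at hL
    rw [touches_cons, not_or] at hg
    exact properLevels_cons.2 ⟨⟨by simp, indepF_insert hsym hL.1.2 hg.1⟩, hL.2⟩

lemma properLevels_insertLevel (hsym : Symmetric sim) (g : F) {L : List (Finset F)}
    (hL : ProperLevels sim L) : ProperLevels sim (insertLevel sim g L) := by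
  induction L with
  | nil => exact hL
  | cons I R ih =>
    have hIR := properLevels_cons.1 hL
    unfold insertLevel
    split_ifs with h1 h2
    · exact properLevels_cons.2 ⟨hIR.1, ih hIR.2⟩
    · exact properLevels_cons.2 ⟨hIR.1, properLevels_addHead hsym hIR.2 h1⟩
    · exact hL

lemma properLevels_prependLevel (hsym : Symmetric sim) (f g : F) {L : List (Finset F)}
    (hL : ProperLevels sim L) : ProperLevels sim (prependLevel sim f g L) := by
  unfold prependLevel
  split_ifs with h1 h2
  · exact properLevels_singleton f
  · exact h1 ▸ hL
  · exact properLevels_insertLevel hsym g hL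

lemma properLevels_levels (hsym : Symmetric sim) (f : F) (w : List F) :
    ProperLevels sim (levels sim f w) := by
  induction w with
  | nil => simp [levels, ProperLevels]
  | cons g w ih => exact properLevels_prependLevel hsym f g ih

lemma headD_insertLevel (g : F) (L : List (Finset F)) :
    (insertLevel sim g L).headD ∅ = L.headD ∅ := by
  cases L with
  | nil => rfl
  | cons I R => unfold insertLevel; split_ifs <;> rfl

lemma headD_levels (f : F) (w : List F) (h : levels sim f w ≠ []) :
    (levels sim f w).headD ∅ = {f} := by
  induction w with
  | nil => exact absurd rfl h
  | cons g w ih =>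
    simp only [levels, prependLevel] at h ⊢
    split_ifs at h ⊢ with h1 h2
    · rfl
    · exact absurd rfl h
    · rw [headD_insertLevel, ih h1]

lemma mem_of_exposed {g : F} {L : List (Finset F)} (h : Exposed sim g L) : ∃ I ∈ L, g ∈ I := by
  induction L with
  | nil => exact h.elim
  | cons I R ih =>
    rcases h with h | h
    · obtain ⟨J, hJ, hg⟩ := ih h
      exact ⟨J, by simp [hJ], hg⟩
    · exact ⟨I, by simp, h.1⟩

lemma exposed_addHead {g h : F} (hne : h ≠ g) {L : List (Finset F)}
    (hh : Exposed sim h (addHead g L)) : Exposed sim h L := by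
  cases L with
  | nil => simp [addHead, Exposed, hne] at hh
  | cons J R => simpa [addHead, Exposed, hne] using hh

lemma not_sim_of_not_touches {g h : F} {L : List (Finset F)}
    (hL : ∃ I ∈ L, h ∈ I) (hg : ¬ Touches sim g L) : ¬ sim h g := by
  obtain ⟨I, hI, hhI⟩ := hL
  exact fun hs => hg ⟨I, hI, h, hhI, Or.inr hs⟩

lemma exists_mem_addHead {g h : F} {L : List (Finset F)} {n : ℕ}
    (hh : ∃ I ∈ L.drop n, h ∈ I) : ∃ I ∈ (addHead g L).drop n, h ∈ I := by
  obtain ⟨I, hI, hhI⟩ := hh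
  cases L with
  | nil => simp at hI
  | cons J R =>
    cases n with
    | zero =>
      rcases List.mem_cons.1 hI with rfl | hI
      · exact ⟨insert g I, by simp [addHead], by simp [hhI]⟩
      · exact ⟨I, by simp [addHead, hI], hhI⟩
    | succ n => exact ⟨I, by simpa [addHead] using hI, hhI⟩

lemma exists_self_mem_addHead (g : F) (L : List (Finset F)) : ∃ I ∈ addHead g L, g ∈ I := by
  cases L <;> simp [addHead]

lemma exists_mem_insertLevel {g h : F} {L : List (Finset F)} {n : ℕ}
    (hh : ∃ I ∈ L.drop n, h ∈ I) : ∃ I ∈ (insertLevel sim g L).drop n, h ∈ I := by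
  induction L generalizing n with
  | nil => exact hh
  | cons J R ih =>
    have key : ∀ R' : List (Finset F),
        (∀ m, (∃ I ∈ R.drop m, h ∈ I) → ∃ I ∈ R'.drop m, h ∈ I) →
          ∃ I ∈ (J :: R').drop n, h ∈ I := by
      intro R' hR'
      cases n with
      | zero =>
        obtain ⟨I, hI, hhI⟩ := hh
        rcases List.mem_cons.1 hI with rfl | hI
        · exact ⟨I, by simp, hhI⟩
        · obtain ⟨I', hI', hhI'⟩ := hR' 0 ⟨I, hI, hhI⟩
          exact ⟨I', List.mem_cons_of_mem _ hI', hhI'⟩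
      | succ n => exact hR' n hh
    unfold insertLevel
    split_ifs with h1 h2
    · exact key _ fun m => ih
    · exact key _ fun m => exists_mem_addHead
    · exact hh

lemma Touches.of_drop {g : F} {L : List (Finset F)} {n : ℕ} (h : Touches sim g (L.drop n)) :
    Touches sim g L := by
  obtain ⟨I, hI, hg⟩ := h
  exact ⟨I, List.mem_of_mem_drop hI, hg⟩

lemma exists_self_mem_insertLevel {g : F} {L : List (Finset F)} {n : ℕ}
    (hg : Touches sim g (L.drop n)) : ∃ I ∈ (insertLevel sim g L).drop (n + 1), g ∈ I := by
  induction L generalizing n with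
  | nil => simp [not_touches_nil] at hg
  | cons J R ih =>
    unfold insertLevel
    split_ifs with h1 h2
    · cases n with
      | zero =>
        obtain ⟨I, hI, hgI⟩ := ih (n := 0) h1
        exact ⟨I, List.mem_of_mem_drop hI, hgI⟩
      | succ n => exact ih hg
    · cases n with
      | zero => exact exists_self_mem_addHead g R
      | succ n => exact absurd (Touches.of_drop (n := n) hg) h1
    · exact absurd (touches_cons.1 hg.of_drop) (by tauto)

lemma touches_of_mem_headD {g : F} {L : List (Finset F)} (h : g ∈ L.headD ∅) :
    Touches sim g L := by
  cases L with
  | nil => simp at h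
  | cons I R => exact touches_cons.2 (Or.inl (touches_singleton_of_mem h))

lemma exists_mem_levels_of_chain (f : F) {w : List F} {u : F} {U : List F}
    (hsub : (u :: U).Sublist w) (hch : (u :: U).IsChain fun a b => a = b ∨ sim a b)
    (hsym : Symmetric sim) (hlast : (u :: U).getLast? = some f) :
    ∃ I ∈ (levels sim f w).drop U.length, u ∈ I := by
  induction w generalizing u U with
  | nil => simp at hsub
  | cons g w ih =>
    have hne : ∀ {v : F} {n : ℕ}, (∃ I ∈ (levels sim f w).drop n, v ∈ I) →
        levels sim f w ≠ [] := by
      rintro v n ⟨I, hI, -⟩ h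
      simp [h] at hI
    simp only [levels, prependLevel]
    cases hsub with
    | cons _ hsub =>
      have h := ih hsub hch hlast
      rw [if_neg (hne h)]
      exact exists_mem_insertLevel h
    | cons_cons _ hsub =>
      cases U with
      | nil =>
        obtain rfl : f = g := by simpa using hlast.symm
        rw [if_pos (rfl : f = f)]
        split_ifs with h1
        · simp
        · have ht : Touches sim f (levels sim f w) :=
            touches_of_mem_headD (by rw [headD_levels f w h1]; simp)
          obtain ⟨I, hI, hu⟩ := exists_self_mem_insertLevel (n := 0) ht
          exact ⟨I, List.mem_of_mem_drop hI, hu⟩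
      | cons v U =>
        rw [List.isChain_cons_cons] at hch
        have h := ih hsub hch.2 (by simpa using hlast)
        rw [if_neg (hne h)]
        obtain ⟨I, hI, hv⟩ := h
        exact exists_self_mem_insertLevel ⟨I, hI, v, hv, hch.1.imp id fun h => hsym h⟩

lemma le_length_levels (hsym : Symmetric sim) {f : F} {w U : List F} (hU : U ≠ [])
    (hsub : U.Sublist w) (hch : U.IsChain fun a b => a = b ∨ sim a b)
    (hlast : U.getLast? = some f) : U.length ≤ (levels sim f w).length := by
  cases U with
  | nil => exact absurd rfl hU
  | cons u U =>
    obtain ⟨I, hI, -⟩ := exists_mem_levels_of_chain f hsub hch hsym hlast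
    have := List.length_pos_of_mem hI
    rw [List.length_drop] at this
    rw [List.length_cons]
    omega

lemma exposed_insertLevel (hsym : Symmetric sim) {g h : F} (hne : h ≠ g) {L : List (Finset F)}
    (hh : Exposed sim h (insertLevel sim g L)) : Exposed sim h L ∧ ¬ sim h g := by
  by_cases hg : Touches sim g L
  swap
  · rw [insertLevel_of_not_touches hg] at hh
    exact ⟨hh, not_sim_of_not_touches (mem_of_exposed hh) hg⟩
  induction L with
  | nil => exact absurd hg (not_touches_nil g)
  | cons I R ih =>
    have key : ∀ R' : List (Finset F), (∃ J ∈ R', g ∈ J) → ¬ Touches sim h R' → ¬ sim h g := by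
      rintro R' hR' hh' hs
      exact not_sim_of_not_touches hR' hh' (hsym hs)
    have mono : ∀ R' : List (Finset F), (∀ a, (∃ J ∈ R, a ∈ J) → ∃ J ∈ R', a ∈ J) →
        ¬ Touches sim h R' → ¬ Touches sim h R := by
      rintro R' hR' hh' ⟨J, hJ, a, ha, hs⟩
      obtain ⟨J', hJ', ha'⟩ := hR' a ⟨J, hJ, ha⟩
      exact hh' ⟨J', hJ', a, ha', hs⟩
    unfold insertLevel at hh
    split_ifs at hh with h1 h2
    · rcases hh with hh | ⟨hI, hh⟩
      · exact (ih hh h1).imp Or.inl id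
      · obtain ⟨J, hJ, hgJ⟩ := exists_self_mem_insertLevel (n := 0) h1
        exact ⟨Or.inr ⟨hI, mono _ (fun a ha => exists_mem_insertLevel (n := 0) ha) hh⟩,
          key _ ⟨J, List.mem_of_mem_drop hJ, hgJ⟩ hh⟩
    · rcases hh with hh | ⟨hI, hh⟩
      · have hR := exposed_addHead hne hh
        exact ⟨Or.inl hR, not_sim_of_not_touches (mem_of_exposed hR) h1⟩
      · exact ⟨Or.inr ⟨hI, mono _ (fun a ha => exists_mem_addHead (n := 0) ha) hh⟩,
          key _ (exists_self_mem_addHead g R) hh⟩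
    · exact absurd (touches_cons.1 hg) (by tauto)

lemma stableLevels_singleton (f : F) : StableLevels sim [{f}] :=
  ⟨by simp, ((properLevels_singleton f) _ (by simp)).2, by simp, trivial⟩

lemma stableLevels_addHead (hsym : Symmetric sim) {g : F} {L : List (Finset F)}
    (hL : StableLevels sim L) (hg : ¬ Touches sim g L) : StableLevels sim (addHead g L) := by
  cases L with
  | nil => exact stableLevels_singleton g
  | cons J R =>
    rw [touches_cons, not_or] at hg
    refine ⟨by simp, indepF_insert hsym hL.2.1 hg.1, fun a ha => ?_, hL.2.2.2⟩
    obtain ⟨b, hb, hs⟩ := hL.2.2.1 a ha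
    exact ⟨b, by simp [hb], hs⟩

lemma stableLevels_insertLevel (hsym : Symmetric sim) {g : F} {L : List (Finset F)}
    (hL : StableLevels sim L) (hg : Exposed sim g L → sim g g) :
    StableLevels sim (insertLevel sim g L) := by
  induction L with
  | nil => exact hL
  | cons I R ih =>
    obtain ⟨hI, hIi, hIR, hR⟩ := hL
    unfold insertLevel
    split_ifs with h1 h2
    · exact ⟨hI, hIi, by rwa [headD_insertLevel], ih hR fun h => hg (Or.inl h)⟩
    · refine ⟨hI, hIi, fun a ha => ?_, stableLevels_addHead hsym hR h1⟩
      have ha' : a = g ∨ a ∈ R.headD ∅ := by cases R <;> simpa [addHead] using ha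
      rcases ha' with rfl | ha'
      · obtain ⟨h, hhI, rfl | hs⟩ := touches_singleton.1 h2
        · exact ⟨a, hhI, hg (Or.inr ⟨hhI, h1⟩)⟩
        · exact ⟨h, hhI, hs⟩
      · exact hIR a ha'
    · exact ⟨hI, hIi, hIR, hR⟩

/-- Causality makes the levels of the word of a walk stable: a flaw that has to be addressed
before any flaw touching it must be present at the start. -/
lemma stableLevels_levels {Ω : Type*} [Fintype Ω] {S : Setup Ω F} (hsym : Symmetric sim)
    (hcaus : Causality S sim) (f : F) {σ : Ω} {l : List (F × Ω)} (hl : ValidFrom S.step σ l) :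
    StableLevels sim (levels sim f (l.map Prod.fst)) ∧
      ∀ g, Exposed sim g (levels sim f (l.map Prod.fst)) → S.mem g σ := by
  induction l generalizing σ with
  | nil => exact ⟨trivial, fun g h => h.elim⟩
  | cons p l ih =>
    obtain ⟨g, σ'⟩ := p
    obtain ⟨hstep, hl⟩ := hl
    obtain ⟨hst, hex⟩ := ih hl
    simp only [List.map_cons, levels, prependLevel]
    split_ifs with h1 h2
    · refine ⟨stableLevels_singleton f, fun h hh => ?_⟩
      obtain rfl : h = f := by simpa [Exposed, not_touches_nil] using hh
      exact h2 ▸ hstep.1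
    · exact ⟨trivial, fun g h => h.elim⟩
    · refine ⟨stableLevels_insertLevel hsym hst fun hg => ?_, fun h hh => ?_⟩
      · rcases hcaus g σ σ' hstep g (hex g hg) with h | h
        · exact absurd rfl h.2
        · exact h
      · by_cases hne : h = g
        · exact hne ▸ hstep.1
        · obtain ⟨hh, hs⟩ := exposed_insertLevel hsym hne hh
          rcases hcaus g σ σ' hstep h (hex h hh) with h' | h'
          · exact h'.1
          · exact absurd (hsym h') hs

end Levels

section Operators

variable {Ω F : Type*} [Fintype Ω]

/-- The transition matrix of the valid steps addressing `f`. -/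
def stepMatrix (S : Setup Ω F) (f : F) : Matrix Ω Ω ℝ :=
  fun σ σ' => if S.step f σ σ' then S.ρ f σ σ' else 0

/-- The transition matrix of the walks with word `w`. -/
def wordMatrix (S : Setup Ω F) (w : List F) : Matrix Ω Ω ℝ := (w.map (stepMatrix S)).prod

/-- The total weight of the walks with word `w`, as a function of the initial state. -/
def wordMass (S : Setup Ω F) (w : List F) : Ω → ℝ := (wordMatrix S w).mulVec 1

variable {S : Setup Ω F} {sim : F → F → Prop}

lemma stepMatrix_nonneg (f : F) (σ σ' : Ω) : 0 ≤ stepMatrix S f σ σ' := by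
  unfold stepMatrix
  split_ifs
  exacts [S.ρ_nonneg _ _ _, le_rfl]

lemma stepMatrix_of_step {f : F} {σ σ' : Ω} (h : S.step f σ σ') :
    stepMatrix S f σ σ' = S.ρ f σ σ' := if_pos h

lemma stepMatrix_mul_le (hsc : StrongComm S sim) {f g : F} (h : ¬ sim f g) (σ₁ σ₃ : Ω) :
    (stepMatrix S f * stepMatrix S g) σ₁ σ₃ ≤ (stepMatrix S g * stepMatrix S f) σ₁ σ₃ := by
  obtain ⟨swap, hval, hinj, hprob⟩ := hsc
  rw [Matrix.mul_apply, Matrix.mul_apply]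
  set T := Finset.univ.filter fun σ₂ => S.step f σ₁ σ₂ ∧ S.step g σ₂ σ₃ with hT
  have hmem : ∀ {σ₂}, σ₂ ∈ T → S.step f σ₁ σ₂ ∧ S.step g σ₂ σ₃ := fun h => by simpa [hT] using h
  calc ∑ σ₂, stepMatrix S f σ₁ σ₂ * stepMatrix S g σ₂ σ₃
      = ∑ σ₂ ∈ T, stepMatrix S f σ₁ σ₂ * stepMatrix S g σ₂ σ₃ := by
        refine (Finset.sum_subset (Finset.subset_univ _) fun σ₂ _ h => ?_).symm
        have h : ¬ (S.step f σ₁ σ₂ ∧ S.step g σ₂ σ₃) := by simpa [hT] using h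
        by_cases h1 : S.step f σ₁ σ₂
        · simp [stepMatrix, show ¬ S.step g σ₂ σ₃ from fun h2 => h ⟨h1, h2⟩]
        · simp [stepMatrix, h1]
    _ = ∑ σ₂ ∈ T, stepMatrix S g σ₁ (swap σ₁ f σ₂ g σ₃) *
          stepMatrix S f (swap σ₁ f σ₂ g σ₃) σ₃ := by
        refine Finset.sum_congr rfl fun σ₂ hσ₂ => ?_
        obtain ⟨h1, h2⟩ := hmem hσ₂
        obtain ⟨h3, h4⟩ := hval _ _ _ _ _ h1 h2 h
        rw [stepMatrix_of_step h1, stepMatrix_of_step h2, stepMatrix_of_step h3,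
          stepMatrix_of_step h4, hprob _ _ _ _ _ h1 h2 h]
    _ = ∑ σ₂ ∈ T.image fun σ₂ => swap σ₁ f σ₂ g σ₃,
          stepMatrix S g σ₁ σ₂ * stepMatrix S f σ₂ σ₃ := by
        rw [Finset.sum_image]
        intro a ha b hb hab
        exact hinj _ _ _ _ _ _ (hmem ha).1 (hmem ha).2 (hmem hb).1 (hmem hb).2 h hab
    _ ≤ _ := Finset.sum_le_sum_of_subset_of_nonneg (Finset.subset_univ _) fun _ _ _ =>
        mul_nonneg (stepMatrix_nonneg _ _ _) (stepMatrix_nonneg _ _ _)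

lemma commute_stepMatrix (hsym : Symmetric sim) (hsc : StrongComm S sim) {f g : F}
    (h : ¬ sim f g) : Commute (stepMatrix S f) (stepMatrix S g) := by
  ext σ₁ σ₃
  exact le_antisymm (stepMatrix_mul_le hsc h σ₁ σ₃)
    (stepMatrix_mul_le hsc (fun h' => h (hsym h')) σ₁ σ₃)

lemma wordMatrix_cons (g : F) (w : List F) :
    wordMatrix S (g :: w) = stepMatrix S g * wordMatrix S w := by simp [wordMatrix]

lemma wordMatrix_append (v w : List F) :
    wordMatrix S (v ++ w) = wordMatrix S v * wordMatrix S w := by simp [wordMatrix]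

lemma wordMass_cons (g : F) (w : List F) :
    wordMass S (g :: w) = (stepMatrix S g).mulVec (wordMass S w) := by
  rw [wordMass, wordMatrix_cons, ← Matrix.mulVec_mulVec, wordMass]

lemma mulVec_stepMatrix_mono (g : F) {v w : Ω → ℝ} (h : v ≤ w) :
    (stepMatrix S g).mulVec v ≤ (stepMatrix S g).mulVec w := fun _ =>
  Finset.sum_le_sum fun σ' _ => mul_le_mul_of_nonneg_left (h σ') (stepMatrix_nonneg _ _ _)

lemma mulVec_wordMatrix_mono (u : List F) {v w : Ω → ℝ} (h : v ≤ w) :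
    (wordMatrix S u).mulVec v ≤ (wordMatrix S u).mulVec w := by
  induction u with
  | nil => simpa [wordMatrix] using h
  | cons g u ih =>
    rw [wordMatrix_cons, ← Matrix.mulVec_mulVec, ← Matrix.mulVec_mulVec]
    exact mulVec_stepMatrix_mono g ih

lemma mulVec_stepMatrix_one_le (g : F) : (stepMatrix S g).mulVec 1 ≤ 1 := by
  intro σ
  simp only [Matrix.mulVec, dotProduct, Pi.one_apply, mul_one]
  by_cases h : S.mem g σ
  · rw [← S.ρ_total g σ h]
    refine Finset.sum_le_sum fun σ' _ => ?_
    unfold stepMatrix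
    split_ifs
    exacts [le_rfl, S.ρ_nonneg _ _ _]
  · simp [stepMatrix, Setup.step, h]

lemma wordMass_nonneg (w : List F) : 0 ≤ wordMass S w := by
  simpa [wordMass] using mulVec_wordMatrix_mono (S := S) w (zero_le_one' (Ω → ℝ))

lemma sum_wordMass_le {ω : Ω → ℝ} (hω : IsPosProb ω) {lam : F → ℝ} (hlam : ∀ f, 0 < lam f)
    (hA : CondA S ω lam) (w : List F) : ∑ σ, ω σ * wordMass S w σ ≤ wordWt lam w := by
  induction w with
  | nil => simp [wordMass, wordMatrix, wordWt, hω.2]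
  | cons g w ih =>
    have hcol : ∀ σ', ∑ σ, ω σ * stepMatrix S g σ σ' ≤ lam g * ω σ' := by
      intro σ'
      refine le_of_eq_of_le ?_ (mul_le_mul_of_nonneg_right (hA g σ') (hω.1 σ').le)
      rw [Finset.sum_mul]
      refine Finset.sum_congr rfl fun σ _ => ?_
      unfold stepMatrix Setup.step
      split_ifs
      · rw [div_mul_cancel₀ _ (hω.1 σ').ne', mul_comm]
      · simp
    calc ∑ σ, ω σ * wordMass S (g :: w) σ
        = ∑ σ', (∑ σ, ω σ * stepMatrix S g σ σ') * wordMass S w σ' := by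
          simp only [wordMass_cons, Matrix.mulVec, dotProduct, Finset.mul_sum, Finset.sum_mul]
          rw [Finset.sum_comm]
          simp only [mul_assoc]
      _ ≤ ∑ σ', lam g * ω σ' * wordMass S w σ' := Finset.sum_le_sum fun σ' _ =>
          mul_le_mul_of_nonneg_right (hcol σ') (wordMass_nonneg w σ')
      _ = lam g * ∑ σ', ω σ' * wordMass S w σ' := by
          rw [Finset.mul_sum]; simp only [mul_assoc]
      _ ≤ lam g * wordWt lam w := mul_le_mul_of_nonneg_left ih (hlam g).le
      _ = wordWt lam (g :: w) := by simp [wordWt]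

lemma commute_wordMatrix {g : F} {w : List F}
    (h : ∀ a ∈ w, Commute (stepMatrix S g) (stepMatrix S a)) :
    Commute (stepMatrix S g) (wordMatrix S w) := by
  refine Commute.list_prod_right _ _ fun M hM => ?_
  obtain ⟨a, ha, rfl⟩ := List.mem_map.1 hM
  exact h a ha

lemma mem_levelWord {g : F} {L : List (Finset F)} : g ∈ levelWord L ↔ ∃ I ∈ L, g ∈ I := by
  induction L with
  | nil => simp [levelWord]
  | cons I R ih => simp [levelWord, ih, or_comm]

lemma commute_wordMatrix_levelWord (hsym : Symmetric sim) (hsc : StrongComm S sim) {g : F}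
    {L : List (Finset F)} (hg : ¬ Touches sim g L) :
    Commute (stepMatrix S g) (wordMatrix S (levelWord L)) := by
  refine commute_wordMatrix fun a ha => commute_stepMatrix hsym hsc fun h => hg ?_
  obtain ⟨I, hI, haI⟩ := mem_levelWord.1 ha
  exact ⟨I, hI, a, haI, Or.inr (hsym h)⟩

lemma wordMatrix_insert (hsym : Symmetric sim) (hsc : StrongComm S sim) {g : F} {J : Finset F}
    (hJ : IndepF sim J) (hg : ¬ Touches sim g [J]) :
    wordMatrix S (insert g J).toList = stepMatrix S g * wordMatrix S J.toList := by
  have hgJ : g ∉ J := fun h => hg (touches_singleton_of_mem h)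
  rw [← wordMatrix_cons]
  refine List.Perm.prod_eq' ((Finset.toList_insert hgJ).map _) ?_
  rw [List.pairwise_map]
  refine List.pairwise_of_forall_mem_list fun a ha b hb => ?_
  rw [Finset.mem_toList] at ha hb
  by_cases hab : a = b
  · exact hab ▸ Commute.refl _
  · exact commute_stepMatrix hsym hsc (indepF_insert hsym hJ hg a ha b hb hab)

lemma wordMatrix_addHead (hsym : Symmetric sim) (hsc : StrongComm S sim) {g : F}
    {L : List (Finset F)} (hL : ProperLevels sim L) (hg : ¬ Touches sim g L) :
    wordMatrix S (levelWord (addHead g L)) = stepMatrix S g * wordMatrix S (levelWord L) := by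
  cases L with
  | nil => simp [addHead, levelWord, wordMatrix]
  | cons J R =>
    rw [properLevels_cons] at hL
    rw [touches_cons, not_or] at hg
    simp only [addHead, levelWord, wordMatrix_append]
    rw [wordMatrix_insert hsym hsc hL.1.2 hg.1, ← mul_assoc, ← mul_assoc,
      (commute_wordMatrix_levelWord hsym hsc hg.2).eq]

lemma wordMatrix_insertLevel (hsym : Symmetric sim) (hsc : StrongComm S sim) {g : F}
    {L : List (Finset F)} (hL : ProperLevels sim L) (hg : Touches sim g L) :
    wordMatrix S (levelWord (insertLevel sim g L)) =
      stepMatrix S g * wordMatrix S (levelWord L) := by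
  induction L with
  | nil => exact absurd hg (not_touches_nil g)
  | cons I R ih =>
    rw [properLevels_cons] at hL
    unfold insertLevel
    split_ifs with h1 h2
    · simp only [levelWord, wordMatrix_append, ih hL.2 h1, mul_assoc]
    · simp only [levelWord, wordMatrix_append, wordMatrix_addHead hsym hsc hL.2 h1, mul_assoc]
    · exact absurd (touches_cons.1 hg) (by tauto)

lemma mulVec_wordMass_levelWord_le (hsym : Symmetric sim) (hsc : StrongComm S sim) (f g : F)
    {L : List (Finset F)} (hL : ProperLevels sim L) :
    (stepMatrix S g).mulVec (wordMass S (levelWord L)) ≤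
      wordMass S (levelWord (prependLevel sim f g L)) := by
  by_cases hg : Touches sim g (prependLevel sim f g L)
  · refine le_of_eq ?_
    rw [wordMass, wordMass, Matrix.mulVec_mulVec]
    congr 1
    unfold prependLevel at hg ⊢
    split_ifs at hg ⊢ with h1 h2
    · subst h1 h2
      exact (wordMatrix_addHead hsym hsc hL (not_touches_nil g)).symm
    · exact absurd hg (not_touches_nil g)
    · exact (wordMatrix_insertLevel hsym hsc hL (touches_insertLevel_self.1 hg)).symm
  · have h := prependLevel_eq_of_not_touches hg
    rw [h] at hg ⊢
    rw [wordMass, Matrix.mulVec_mulVec, (commute_wordMatrix_levelWord hsym hsc hg).eq,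
      ← Matrix.mulVec_mulVec]
    exact mulVec_wordMatrix_mono _ (mulVec_stepMatrix_one_le g)

end Operators

section Walks

variable {Ω F : Type*} [Fintype Ω] {S : Setup Ω F} {sim : F → F → Prop}

/-- The walks of a prefix-free family that follow a strategy from a given state and whose words
have given levels weigh at most as much as the walks with the corresponding word. -/
lemma sum_prodRho_le (hsym : Symmetric sim) (hsc : StrongComm S sim) (f : F) (n : ℕ) (σ : Ω)
    (Λ : List (F × Ω) → F) (L : List (Finset F)) (Y : Finset (List (F × Ω)))
    (hval : ∀ l ∈ Y, ValidFrom S.step σ l)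
    (hfol : ∀ l ∈ Y, ∀ (i : ℕ) (h : i < l.length), (l.get ⟨i, h⟩).1 = Λ (l.take i))
    (hpre : ∀ l ∈ Y, ∀ l' ∈ Y, l <+: l' → l = l')
    (hL : ∀ l ∈ Y, levels sim f (l.map Prod.fst) = L)
    (hn : ∀ l ∈ Y, l.length ≤ n) :
    ∑ l ∈ Y, prodRho S.ρ σ l ≤ wordMass S (levelWord L) σ := by
  induction n generalizing σ Λ L Y with
  | zero =>
    rcases Y.eq_empty_or_nonempty with rfl | ⟨l, hl⟩
    · simpa using wordMass_nonneg _ σ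
    · obtain rfl : l = [] := List.length_eq_zero_iff.1 (Nat.le_zero.1 (hn l hl))
      obtain rfl : Y = {[]} := Finset.eq_singleton_iff_unique_mem.2
        ⟨hl, fun l' hl' => (hpre _ hl _ hl' List.nil_prefix).symm⟩
      rw [← hL [] hl]
      simp [prodRho, levels, levelWord, wordMass, wordMatrix]
  | succ n ih =>
    rcases Y.eq_empty_or_nonempty with rfl | ⟨l₀, hl₀⟩
    · simpa using wordMass_nonneg _ σ
    by_cases hnil : [] ∈ Y
    · exact ih σ Λ L Y hval hfol hpre hL fun l hl => by
        rw [← hpre _ hnil _ hl List.nil_prefix]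
        simp
    set g := Λ []
    have hform : ∀ l ∈ Y, ∃ σ' r, l = (g, σ') :: r := by
      intro l hl
      cases l with
      | nil => exact absurd hl hnil
      | cons p r =>
        have := hfol _ hl 0 (by simp)
        exact ⟨p.2, r, by rw [← show p.1 = g by simpa using this]⟩
    set T : Ω → Finset (List (F × Ω)) := fun σ' =>
      Y.preimage (fun r => (g, σ') :: r) (fun _ _ _ _ h => (List.cons.inj h).2)
    have hTmem : ∀ {σ' r}, r ∈ T σ' ↔ (g, σ') :: r ∈ Y := Finset.mem_preimage
    set L' := unprependLevel sim g L with hL'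
    have hlev : ∀ {σ' r}, r ∈ T σ' → levels sim f (r.map Prod.fst) = L' := by
      intro σ' r hr
      rw [hL', ← hL _ (hTmem.1 hr)]
      exact (unprependLevel_prependLevel f g (properLevels_levels hsym f _)).symm
    have hL'L : ProperLevels sim L' ∧ prependLevel sim f g L' = L := by
      obtain ⟨σ', r, rfl⟩ := hform l₀ hl₀
      rw [← hlev (hTmem.2 hl₀)]
      exact ⟨properLevels_levels hsym f _, hL _ hl₀⟩
    calc ∑ l ∈ Y, prodRho S.ρ σ l
        = ∑ p ∈ Finset.univ.sigma T, S.ρ g σ p.1 * prodRho S.ρ p.1 p.2 := by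
          symm
          refine Finset.sum_bij (fun p _ => (g, p.1) :: p.2) ?_ ?_ ?_ ?_
          · intro p hp
            exact hTmem.1 (Finset.mem_sigma.1 hp).2
          · rintro ⟨σ₁, r₁⟩ - ⟨σ₂, r₂⟩ - h
            simp only [List.cons.injEq, Prod.mk.injEq, true_and] at h
            obtain ⟨rfl, rfl⟩ := h
            rfl
          · intro l hl
            obtain ⟨σ', r, rfl⟩ := hform l hl
            exact ⟨⟨σ', r⟩, Finset.mem_sigma.2 ⟨Finset.mem_univ _, hTmem.2 hl⟩, rfl⟩
          · intro p _
            rfl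
      _ = ∑ σ', ∑ r ∈ T σ', S.ρ g σ σ' * prodRho S.ρ σ' r := Finset.sum_sigma _ _ _
      _ ≤ ∑ σ', stepMatrix S g σ σ' * wordMass S (levelWord L') σ' := by
          refine Finset.sum_le_sum fun σ' _ => ?_
          rcases (T σ').eq_empty_or_nonempty with h | ⟨r, hr⟩
          · rw [h, Finset.sum_empty]
            exact mul_nonneg (stepMatrix_nonneg _ _ _) (wordMass_nonneg _ σ')
          · rw [stepMatrix_of_step (hval _ (hTmem.1 hr)).1, ← Finset.mul_sum]
            refine mul_le_mul_of_nonneg_left ?_ (S.ρ_nonneg _ _ _)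
            refine ih σ' (fun l => Λ ((g, σ') :: l)) L' (T σ') ?_ ?_ ?_ ?_ ?_
            · exact fun l hl => (hval _ (hTmem.1 hl)).2
            · intro l hl i h
              simpa using hfol _ (hTmem.1 hl) (i + 1) (by simpa using h)
            · intro l hl l' hl' h
              exact (List.cons.inj (hpre _ (hTmem.1 hl) _ (hTmem.1 hl')
                ((List.prefix_cons_inj _).2 h))).2
            · exact fun l hl => hlev hl
            · intro l hl
              simpa using hn _ (hTmem.1 hl)
      _ = (stepMatrix S g).mulVec (wordMass S (levelWord L')) σ := rfl
      _ ≤ wordMass S (levelWord L) σ := by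
          rw [← hL'L.2]
          exact mulVec_wordMass_levelWord_le hsym hsc f g hL'L.1 σ

lemma prodRho_nonneg (σ : Ω) (l : List (F × Ω)) : 0 ≤ prodRho S.ρ σ l := by
  induction l generalizing σ with
  | nil => exact zero_le_one
  | cons p l ih => exact mul_nonneg (S.ρ_nonneg _ _ _) (ih p.2)

lemma le_gammaInit_mul [Nonempty Ω] {ω ωinit : Ω → ℝ} (hω : IsPosProb ω) (σ : Ω) :
    ωinit σ ≤ gammaInit ωinit ω * ω σ := by
  rw [← div_le_iff₀ (hω.1 σ)]
  exact Finset.le_sup' (fun σ => ωinit σ / ω σ) (Finset.mem_univ σ)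

lemma gammaInit_nonneg [Nonempty Ω] {ω ωinit : Ω → ℝ} (hω : IsPosProb ω) (hinit : IsProb ωinit) :
    0 ≤ gammaInit ωinit ω := by
  obtain ⟨σ⟩ := ‹Nonempty Ω›
  exact (div_nonneg (hinit.1 σ) (hω.1 σ).le).trans
    (Finset.le_sup' (fun σ => ωinit σ / ω σ) (Finset.mem_univ σ))

lemma ValidSet.mono {X Y : Set (Walk Ω F)} (hX : ValidSet S X) (h : Y ⊆ X) : ValidSet S Y := by
  obtain ⟨h1, ⟨Λ, h2, h3⟩, h4⟩ := hX
  exact ⟨fun τ hτ => h1 τ (h hτ), ⟨Λ, h2, fun τ hτ => h3 τ (h hτ)⟩,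
    fun τ hτ τ' hτ' => h4 τ (h hτ) τ' (h hτ')⟩

lemma sum_wt_le_of_levels [Nonempty Ω] (hsym : Symmetric sim) (hsc : StrongComm S sim)
    {ω ωinit : Ω → ℝ} (hω : IsPosProb ω) (hinit : IsProb ωinit) {lam : F → ℝ}
    (hlam : ∀ f, 0 < lam f) (hA : CondA S ω lam) (f : F) {X : Finset (Walk Ω F)}
    (hX : ValidSet S (X : Set (Walk Ω F))) (L : List (Finset F))
    (hL : ∀ τ ∈ X, levels sim f τ.word = L) :
    ∑ τ ∈ X, τ.wt ωinit S.ρ ≤ gammaInit ωinit ω * wordWt lam (levelWord L) := by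
  obtain ⟨hval, ⟨Λ, -, hfol⟩, hpre⟩ := hX
  have hstate : ∀ σ, ∑ τ ∈ X with τ.start = σ, τ.wt ωinit S.ρ ≤
      ωinit σ * wordMass S (levelWord L) σ := by
    intro σ
    set Y := X.preimage (fun l => Walk.mk σ l) (fun _ _ _ _ h => by simpa using h)
    have hmem : ∀ {l}, l ∈ Y ↔ Walk.mk σ l ∈ X := Finset.mem_preimage
    have hsum : ∑ τ ∈ X with τ.start = σ, τ.wt ωinit S.ρ =
        ωinit σ * ∑ l ∈ Y, prodRho S.ρ σ l := by
      rw [Finset.mul_sum]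
      symm
      refine Finset.sum_bij (fun l _ => Walk.mk σ l) ?_ ?_ ?_ ?_
      · intro l hl
        simpa using hmem.1 hl
      · intro l _ l' _ h
        simpa using h
      · rintro ⟨σ', l⟩ hl
        obtain ⟨hl', rfl⟩ := Finset.mem_filter.1 hl
        exact ⟨l, hmem.2 hl', rfl⟩
      · intro l _
        rfl
    rw [hsum]
    refine mul_le_mul_of_nonneg_left ?_ (hinit.1 σ)
    refine sum_prodRho_le hsym hsc f (Y.sup List.length) σ (fun l => Λ ⟨σ, l⟩) L Y ?_ ?_ ?_ ?_ ?_
    · exact fun l hl => hval _ (hmem.1 hl)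
    · exact fun l hl => hfol _ (hmem.1 hl)
    · intro l hl l' hl' h
      simpa using hpre _ (hmem.1 hl) _ (hmem.1 hl') ⟨rfl, h⟩
    · exact fun l hl => hL _ (hmem.1 hl)
    · exact fun l hl => Finset.le_sup (f := List.length) hl
  calc ∑ τ ∈ X, τ.wt ωinit S.ρ
      = ∑ σ, ∑ τ ∈ X with τ.start = σ, τ.wt ωinit S.ρ := (Finset.sum_fiberwise _ _ _).symm
    _ ≤ ∑ σ, gammaInit ωinit ω * (ω σ * wordMass S (levelWord L) σ) := by
        refine Finset.sum_le_sum fun σ _ => (hstate σ).trans ?_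
        rw [← mul_assoc]
        exact mul_le_mul_of_nonneg_right (le_gammaInit_mul hω σ) (wordMass_nonneg _ σ)
    _ = gammaInit ωinit ω * ∑ σ, ω σ * wordMass S (levelWord L) σ := (Finset.mul_sum _ _ _).symm
    _ ≤ _ := mul_le_mul_of_nonneg_left (sum_wordMass_le hω hlam hA _)
        (gammaInit_nonneg hω hinit)

end Walks

section Counting

variable {F : Type*} {sim : F → F → Prop}

lemma IndepF.subset {I J : Finset F} (hJ : IndepF sim J) (h : I ⊆ J) : IndepF sim I :=
  fun a ha b hb => hJ a (h ha) b (h hb)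

lemma wordWt_levelWord_cons (lam : F → ℝ) (I : Finset F) (R : List (Finset F)) :
    wordWt lam (levelWord (I :: R)) = (∏ f ∈ I, lam f) * wordWt lam (levelWord R) := by
  simp [wordWt, levelWord, mul_comm, Finset.prod_map_toList]

lemma length_le_length_levelWord {L : List (Finset F)} (hL : ProperLevels sim L) :
    L.length ≤ (levelWord L).length := by
  induction L with
  | nil => simp
  | cons I R ih =>
    rw [properLevels_cons] at hL
    have := ih hL.2
    have := hL.1.1.card_pos
    simp only [levelWord, List.length_cons, List.length_append, Finset.length_toList]
    omega

lemma wordWt_mul_const (c : ℝ) (lam : F → ℝ) (w : List F) :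
    wordWt (fun f => c * lam f) w = c ^ w.length * wordWt lam w := by
  induction w with
  | nil => simp [wordWt]
  | cons g w ih =>
    simp only [wordWt, List.map_cons, List.prod_cons, List.length_cons] at ih ⊢
    rw [ih, pow_succ]
    ring

lemma wordWt_nonneg {lam : F → ℝ} (hlam : ∀ f, 0 < lam f) (w : List F) : 0 ≤ wordWt lam w := by
  refine List.prod_nonneg fun x hx => ?_
  obtain ⟨a, -, rfl⟩ := List.mem_map.1 hx
  exact (hlam a).le

variable [Fintype F]

/-- The independent sets all of whose elements have a neighbour in `I`. -/
def indepNeighbors (sim : F → F → Prop) (I : Finset F) : Finset (Finset F) :=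
  Finset.univ.filter fun J => (∀ g ∈ J, ∃ h ∈ I, sim h g) ∧ IndepF sim J

lemma sum_indepNeighbors_insert_le {μ : F → ℝ} (hμ : ∀ f, 0 < μ f) (f : F) (I : Finset F) :
    ∑ J ∈ indepNeighbors sim (insert f I), ∏ g ∈ J, μ g ≤
      (∑ J ∈ Finset.univ.filter (fun J : Finset F => (∀ g ∈ J, sim f g) ∧ IndepF sim J),
        ∏ g ∈ J, μ g) * ∑ J ∈ indepNeighbors sim I, ∏ g ∈ J, μ g := by
  have hpos : ∀ J : Finset F, 0 ≤ ∏ g ∈ J, μ g := fun J => Finset.prod_nonneg fun g _ => (hμ g).le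
  rw [Finset.sum_mul_sum, ← Finset.sum_product']
  set split : Finset F → Finset F × Finset F := fun J =>
    (J.filter (sim f ·), J.filter (¬ sim f ·)) with hsplit
  have hinj : Function.Injective split := by
    intro J J' h
    obtain ⟨h1, h2⟩ := Prod.mk.inj h
    rw [← Finset.filter_union_filter_not_eq (sim f ·) J, h1, h2,
      Finset.filter_union_filter_not_eq]
  calc ∑ J ∈ indepNeighbors sim (insert f I), ∏ g ∈ J, μ g
      = ∑ p ∈ (indepNeighbors sim (insert f I)).image split,
          (∏ g ∈ p.1, μ g) * ∏ g ∈ p.2, μ g := by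
        rw [Finset.sum_image fun _ _ _ _ h => hinj h]
        exact Finset.sum_congr rfl fun J _ => (Finset.prod_filter_mul_prod_filter_not _ _ _).symm
    _ ≤ _ := by
        refine Finset.sum_le_sum_of_subset_of_nonneg ?_ fun p _ _ => mul_nonneg (hpos _) (hpos _)
        intro p hp
        obtain ⟨J, hJ, rfl⟩ := Finset.mem_image.1 hp
        simp only [indepNeighbors, Finset.mem_filter, Finset.mem_univ, true_and] at hJ
        simp only [indepNeighbors, hsplit, Finset.mem_product, Finset.mem_filter,
          Finset.mem_univ, true_and]
        refine ⟨⟨fun g hg => hg.2, hJ.2.subset (Finset.filter_subset _ _)⟩,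
          fun g hg => ?_, hJ.2.subset (Finset.filter_subset _ _)⟩
        obtain ⟨h, hh, hs⟩ := hJ.1 g hg.1
        rcases Finset.mem_insert.1 hh with rfl | hh
        · exact absurd hs hg.2
        · exact ⟨h, hh, hs⟩

lemma prod_mul_sum_indepNeighbors_le {lam μ : F → ℝ} (hlam : ∀ f, 0 < lam f) (hμ : ∀ f, 0 < μ f)
    (hCE : ∀ f, lam f * ∑ J ∈ Finset.univ.filter
      (fun J : Finset F => (∀ g ∈ J, sim f g) ∧ IndepF sim J), ∏ g ∈ J, μ g ≤ μ f)
    (I : Finset F) :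
    (∏ f ∈ I, lam f) * ∑ J ∈ indepNeighbors sim I, ∏ g ∈ J, μ g ≤ ∏ f ∈ I, μ f := by
  induction I using Finset.induction_on with
  | empty =>
    have h : indepNeighbors sim (∅ : Finset F) = {∅} := by
      ext J
      simp only [indepNeighbors, Finset.mem_filter, Finset.mem_univ, true_and,
        Finset.mem_singleton]
      constructor
      · rintro ⟨h, -⟩
        exact Finset.eq_empty_of_forall_notMem fun g hg => by simpa using h g hg
      · rintro rfl
        simp [IndepF]
    simp [h]
  | insert f I hf ih =>
    rw [Finset.prod_insert hf, Finset.prod_insert hf]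
    have hl : 0 ≤ ∏ g ∈ I, lam g := Finset.prod_nonneg fun g _ => (hlam g).le
    have hs : 0 ≤ ∑ J ∈ indepNeighbors sim I, ∏ g ∈ J, μ g :=
      Finset.sum_nonneg fun J _ => Finset.prod_nonneg fun g _ => (hμ g).le
    refine (mul_le_mul_of_nonneg_left (sum_indepNeighbors_insert_le hμ f I)
      (mul_nonneg (hlam f).le hl)).trans ?_
    rw [mul_mul_mul_comm]
    exact mul_le_mul (hCE f) ih (mul_nonneg hl hs) (hμ f).le

/-- Stable sequences of levels with a given first level have total weight at most the `μ`-weight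
of that level. -/
lemma sum_wordWt_levelWord_le {lam μ : F → ℝ} (hlam : ∀ f, 0 < lam f) (hμ : ∀ f, 0 < μ f)
    (hCE : ∀ f, lam f * ∑ J ∈ Finset.univ.filter
      (fun J : Finset F => (∀ g ∈ J, sim f g) ∧ IndepF sim J), ∏ g ∈ J, μ g ≤ μ f)
    (n : ℕ) (I : Finset F) (Φ : Finset (List (Finset F)))
    (hst : ∀ L ∈ Φ, StableLevels sim L) (hI : ∀ L ∈ Φ, L.headD ∅ = I)
    (hn : ∀ L ∈ Φ, L.length ≤ n) :
    ∑ L ∈ Φ, wordWt lam (levelWord L) ≤ ∏ f ∈ I, μ f := by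
  induction n generalizing I Φ with
  | zero =>
    have hsub : Φ ⊆ {[]} := fun L hL => by simpa using hn L hL
    rcases Finset.subset_singleton_iff.1 hsub with rfl | rfl
    · simpa using Finset.prod_nonneg fun g _ => (hμ g).le
    · rw [← hI [] (by simp)]
      simp [wordWt, levelWord]
  | succ n ih =>
    rcases I.eq_empty_or_nonempty with rfl | hne
    · refine ih ∅ Φ hst hI fun L hL => ?_
      cases L with
      | nil => simp
      | cons J R => exact absurd (hI _ hL) (hst _ hL).1.ne_empty
    have hform : ∀ L ∈ Φ, ∃ R, L = I :: R := by
      intro L hL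
      cases L with
      | nil => exact absurd (hI _ hL).symm hne.ne_empty
      | cons J R => exact ⟨R, by rw [← hI _ hL]; rfl⟩
    set Ψ := Φ.preimage (fun R => I :: R) (fun _ _ _ _ h => (List.cons.inj h).2)
    have hmem : ∀ {R}, R ∈ Ψ ↔ I :: R ∈ Φ := Finset.mem_preimage
    calc ∑ L ∈ Φ, wordWt lam (levelWord L)
        = ∑ R ∈ Ψ, (∏ f ∈ I, lam f) * wordWt lam (levelWord R) := by
          symm
          refine Finset.sum_bij (fun R _ => I :: R) (fun R hR => hmem.1 hR)
            (fun _ _ _ _ h => (List.cons.inj h).2) ?_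
            (fun R _ => (wordWt_levelWord_cons lam I R).symm)
          intro L hL
          obtain ⟨R, rfl⟩ := hform L hL
          exact ⟨R, hmem.2 hL, rfl⟩
      _ = (∏ f ∈ I, lam f) * ∑ J ∈ indepNeighbors sim I,
            ∑ R ∈ Ψ with R.headD ∅ = J, wordWt lam (levelWord R) := by
          rw [Finset.sum_fiberwise_of_maps_to, Finset.mul_sum]
          intro R hR
          obtain ⟨-, -, h, hR⟩ := hst _ (hmem.1 hR)
          simp only [indepNeighbors, Finset.mem_filter, Finset.mem_univ, true_and]
          refine ⟨h, ?_⟩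
          cases R with
          | nil => simp [IndepF]
          | cons J R => exact hR.2.1
      _ ≤ (∏ f ∈ I, lam f) * ∑ J ∈ indepNeighbors sim I, ∏ g ∈ J, μ g := by
          refine mul_le_mul_of_nonneg_left (Finset.sum_le_sum fun J _ => ?_)
            (Finset.prod_nonneg fun g _ => (hlam g).le)
          refine ih J _ (fun R hR => ?_) (fun R hR => ?_) (fun R hR => ?_)
          · exact (hst _ (hmem.1 (Finset.mem_filter.1 hR).1)).2.2.2
          · exact (Finset.mem_filter.1 hR).2
          · simpa using hn _ (hmem.1 (Finset.mem_filter.1 hR).1)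
      _ ≤ ∏ f ∈ I, μ f := prod_mul_sum_indepNeighbors_le hlam hμ hCE I

lemma sum_wordWt_levelWord_le_pow {lam μ : F → ℝ} {θ : ℝ} (hlam : ∀ f, 0 < lam f)
    (hμ : ∀ f, 0 < μ f) (hθ0 : 0 < θ) (hθ1 : θ < 1) (hCE : ClusterCond sim lam μ θ) (s : ℕ)
    (f : F) (Φ : Finset (List (Finset F))) (hst : ∀ L ∈ Φ, StableLevels sim L)
    (hprop : ∀ L ∈ Φ, ProperLevels sim L) (hf : ∀ L ∈ Φ, L.headD ∅ = {f})
    (hs : ∀ L ∈ Φ, s ≤ L.length) :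
    ∑ L ∈ Φ, wordWt lam (levelWord L) ≤ μ f * θ ^ s := by
  set lam' : F → ℝ := fun f => θ⁻¹ * lam f with hlam'_def
  have hlam' : ∀ f, 0 < lam' f := fun f => mul_pos (inv_pos.2 hθ0) (hlam f)
  have hlam_eq : lam = fun f => θ * lam' f := by
    funext f
    simp [hlam'_def, hθ0.ne']
  have hsum := sum_wordWt_levelWord_le (sim := sim) hlam' hμ (fun f => by
    have h := hCE f
    rw [div_mul_eq_mul_div, div_le_iff₀ (hμ f)] at h
    rw [hlam'_def]
    dsimp only
    rw [mul_assoc, inv_mul_le_iff₀ hθ0]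
    exact h) (Φ.sup List.length) {f} Φ hst hf fun L hL => Finset.le_sup (f := List.length) hL
  rw [Finset.prod_singleton] at hsum
  calc ∑ L ∈ Φ, wordWt lam (levelWord L)
      ≤ ∑ L ∈ Φ, θ ^ s * wordWt lam' (levelWord L) := by
        refine Finset.sum_le_sum fun L hL => ?_
        rw [hlam_eq, wordWt_mul_const]
        exact mul_le_mul_of_nonneg_right (pow_le_pow_of_le_one hθ0.le hθ1.le
          ((hs L hL).trans (length_le_length_levelWord (hprop L hL)))) (wordWt_nonneg hlam' _)
    _ ≤ μ f * θ ^ s := by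
        rw [← Finset.mul_sum, mul_comm]
        exact mul_le_mul_of_nonneg_right hsum (pow_nonneg hθ0.le s)

end Counting

/-- if `(ρ,∼)` is strongly commutative then for every valid set `X` of walks
each containing a chain of length `s` ending with `f`, `∑_{τ∈X} p(τ) ≤ γ^init μ_f θ^s`;
consequently, for every valid set of walks each containing a chain of length `s`,
`∑_{τ∈X} p(τ) ≤ γ^init (∑_f μ_f) θ^s`. -/
theorem stmt_8 {Ω F : Type*} [Fintype Ω] [Nonempty Ω] [Fintype F]
    (S : Setup Ω F) (sim : F → F → Prop) (hsym : Symmetric sim) (hcaus : Causality S sim)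
    (hsc : StrongComm S sim)
    (ω ωinit : Ω → ℝ) (hω : IsPosProb ω) (hinit : IsProb ωinit)
    (lam μ : F → ℝ) (θ : ℝ)
    (hlam : ∀ f, 0 < lam f) (hμ : ∀ f, 0 < μ f) (hθ0 : 0 < θ) (hθ1 : θ < 1)
    (hA : CondA S ω lam) (hCE : ClusterCond sim lam μ θ)
    (s : ℕ) (hs : 1 ≤ s) :
    (∀ (f : F) (X : Finset (Walk Ω F)), ValidSet S ↑X →
      (∀ τ ∈ X, ∃ U : List F, U.length = s ∧ IsChainOf sim U τ ∧ U.getLast? = some f) →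
      (∑ τ ∈ X, Walk.wt ωinit S.ρ τ) ≤ gammaInit ωinit ω * μ f * θ ^ s) ∧
    (∀ X : Finset (Walk Ω F), ValidSet S ↑X →
      (∀ τ ∈ X, ∃ U : List F, U.length = s ∧ IsChainOf sim U τ) →
      (∑ τ ∈ X, Walk.wt ωinit S.ρ τ) ≤ gammaInit ωinit ω * (∑ f : F, μ f) * θ ^ s) := by
  have hflaw : ∀ (f : F) (X : Finset (Walk Ω F)), ValidSet S ↑X →
      (∀ τ ∈ X, ∃ U : List F, U.length = s ∧ IsChainOf sim U τ ∧ U.getLast? = some f) →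
      (∑ τ ∈ X, Walk.wt ωinit S.ρ τ) ≤ gammaInit ωinit ω * μ f * θ ^ s := by
    intro f X hX hchain
    have hlen : ∀ τ ∈ X, s ≤ (levels sim f τ.word).length := by
      intro τ hτ
      obtain ⟨U, rfl, ⟨hsub, hch⟩, hlast⟩ := hchain τ hτ
      exact le_length_levels hsym (List.length_pos_iff.1 hs) hsub hch hlast
    set Φ := X.image fun τ => levels sim f τ.word
    have hΦ : ∀ P : List (Finset F) → Prop, (∀ τ ∈ X, P (levels sim f τ.word)) →
        ∀ L ∈ Φ, P L := fun P hP => Finset.forall_mem_image.2 hP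
    calc ∑ τ ∈ X, Walk.wt ωinit S.ρ τ
        = ∑ L ∈ Φ, ∑ τ ∈ X with levels sim f τ.word = L, Walk.wt ωinit S.ρ τ :=
          (Finset.sum_fiberwise_of_maps_to (fun τ hτ => Finset.mem_image_of_mem _ hτ) _).symm
      _ ≤ ∑ L ∈ Φ, gammaInit ωinit ω * wordWt lam (levelWord L) := by
          refine Finset.sum_le_sum fun L _ => ?_
          exact sum_wt_le_of_levels hsym hsc hω hinit hlam hA f
            (hX.mono (Finset.coe_subset.2 (Finset.filter_subset _ _))) L
            fun τ hτ => (Finset.mem_filter.1 hτ).2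
      _ ≤ gammaInit ωinit ω * (μ f * θ ^ s) := by
          rw [← Finset.mul_sum]
          refine mul_le_mul_of_nonneg_left ?_ (gammaInit_nonneg hω hinit)
          refine sum_wordWt_levelWord_le_pow hlam hμ hθ0 hθ1 hCE s f Φ
            (hΦ _ fun τ hτ => (stableLevels_levels hsym hcaus f (hX.1 τ hτ)).1)
            (hΦ _ fun τ _ => properLevels_levels hsym f _)
            (hΦ _ fun τ hτ => headD_levels f _ ?_) (hΦ _ hlen)
          exact List.length_pos_iff.1 (hs.trans (hlen τ hτ))
      _ = gammaInit ωinit ω * μ f * θ ^ s := (mul_assoc _ _ _).symm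
  refine ⟨hflaw, fun X hX hchain => ?_⟩
  have hlast : ∀ τ ∈ X, ∃ f, ∃ U : List F,
      U.length = s ∧ IsChainOf sim U τ ∧ U.getLast? = some f := by
    intro τ hτ
    obtain ⟨U, hU, hch⟩ := hchain τ hτ
    have hne : U ≠ [] := List.length_pos_iff.1 (hU ▸ hs)
    exact ⟨U.getLast hne, U, hU, hch, List.getLast?_eq_some_getLast hne⟩
  calc ∑ τ ∈ X, Walk.wt ωinit S.ρ τ
      ≤ ∑ f : F, ∑ τ ∈ X with ∃ U : List F,
          U.length = s ∧ IsChainOf sim U τ ∧ U.getLast? = some f, Walk.wt ωinit S.ρ τ := by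
        simp only [Finset.sum_filter]
        rw [Finset.sum_comm]
        refine Finset.sum_le_sum fun τ hτ => ?_
        have hwt : 0 ≤ Walk.wt ωinit S.ρ τ := mul_nonneg (hinit.1 _) (prodRho_nonneg _ _)
        obtain ⟨f, hf⟩ := hlast τ hτ
        refine le_of_eq_of_le (if_pos hf).symm (Finset.single_le_sum (f := fun f : F =>
          if ∃ U : List F, U.length = s ∧ IsChainOf sim U τ ∧ U.getLast? = some f
            then Walk.wt ωinit S.ρ τ else 0) (fun g _ => ?_) (Finset.mem_univ f))
        split_ifs
        exacts [hwt, le_rfl]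
    _ ≤ ∑ f : F, gammaInit ωinit ω * μ f * θ ^ s := by
        refine Finset.sum_le_sum fun f _ => hflaw f _
          (hX.mono (Finset.coe_subset.2 (Finset.filter_subset _ _)))
          fun τ hτ => (Finset.mem_filter.1 hτ).2
    _ = gammaInit ωinit ω * (∑ f : F, μ f) * θ ^ s := by
        rw [← Finset.sum_mul, Finset.mul_sum]

end LLLFormal
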